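/- Let G be a finitely generated infinite group all of whose proper subgroups are finite (for example, an Olshanskii group in which every proper subgroup is finite of fixed prime order p). Then G has no proper subgroups of finite index, and consequently for every field F and every natural number n, every group homomorphism ρ : G → GL_n(F) is trivial; in particular every finite-dimensional representation of G over ℝ or ℂ is trivial. -/

import Mathlib

universe u

theorem Int.isJacobsonRing : IsJacobsonRing ℤ := by
  refine isJacobsonRing_iff_prime_eq.2 fun P hP => ?_
  rcases eq_or_ne P ⊥ with rfl | hne
  · refine le_bot_iff.1 fun x hx => Ideal.mem_bot.2 ?_
    rcases Int.isUnit_iff.1 (Ideal.mem_jacobson_bot.1 hx x) with h | h <;> nlinarith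
  · have := hP.isMaximal hne
    exact Ideal.jacobson_eq_self_of_isMaximal

/-- A field of finite type over `ℤ` is finite. -/
theorem finite_of_finiteType_int (K : Type*) [Field K] [Algebra.FiniteType ℤ K] : Finite K := by
  have := Int.isJacobsonRing
  have hfin : Module.Finite ℤ K := finite_of_finite_type_of_isJacobsonRing ℤ K
  obtain ⟨p, hp⟩ := CharP.exists K
  rcases eq_or_ne p 0 with rfl | hp0
  · have : CharZero K := CharP.charP_to_charZero K
    have hinj : Function.Injective (algebraMap ℤ K) := by
      simpa using (Int.cast_injective (α := K))
    exact absurd (isField_of_isIntegral_of_isField hinj (Field.toIsField K)) Int.not_isField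
  · refine Module.finite_of_fg_torsion K fun {x} => ?_
    refine ⟨⟨(p : ℤ), mem_nonZeroDivisors_of_ne_zero (by exact_mod_cast hp0)⟩, ?_⟩
    simp [Submonoid.smul_def]

/-- In a domain of finite type over `ℤ`, a nonzero element survives in some finite
quotient ring. -/
theorem exists_ideal_finite_quotient_notMem {A : Type*} [CommRing A] [IsDomain A]
    [Algebra.FiniteType ℤ A] {a : A} (ha : a ≠ 0) :
    ∃ m : Ideal A, Finite (A ⧸ m) ∧ a ∉ m := by
  have := Int.isJacobsonRing
  have : IsJacobsonRing A := isJacobsonRing_of_finiteType (A := ℤ)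
  have hbot : (⊥ : Ideal A).jacobson = ⊥ :=
    IsJacobsonRing.out this Ideal.isPrime_bot.isRadical
  by_contra! hall
  refine ha (Ideal.mem_bot.1 (hbot ▸ Ideal.mem_sInf.2 ?_))
  rintro m ⟨-, hm⟩
  refine hall m ?_
  let _ : Field (A ⧸ m) := Ideal.Quotient.field m
  have hft : Algebra.FiniteType ℤ (A ⧸ m) :=
    .of_surjective (Ideal.Quotient.mkₐ ℤ m) (Ideal.Quotient.mkₐ_surjective ℤ m)
  exact @finite_of_finiteType_int (A ⧸ m) _ hft

open Matrix in
/-- A homomorphism from a finitely generated group to `GL n F` factors through `GL n A` for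
a subring `A` of `F` of finite type over `ℤ`. -/
theorem exists_finiteType_factorization {G F n : Type*} [Group G] [Group.FG G] [Field F]
    [Fintype n] [DecidableEq n] (ρ : G →* GL n F) :
    ∃ (A : Subalgebra ℤ F) (σ : G →* GL n A), Algebra.FiniteType ℤ A ∧
      (GeneralLinearGroup.map (n := n) (A.val : A →+* F)).comp σ = ρ := by
  obtain ⟨S, hS⟩ := Group.FG.out (G := G)
  let T : Set F := ⋃ s ∈ S, Set.range (fun k : n × n => (ρ s).val k.1 k.2) ∪
    Set.range (fun k : n × n => (ρ s)⁻¹.val k.1 k.2)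
  have hT : T.Finite := S.finite_toSet.biUnion fun s _ =>
    (Set.finite_range _).union (Set.finite_range _)
  let A : Subalgebra ℤ F := Algebra.adjoin ℤ T
  let φ : GL n A →* GL n F := GeneralLinearGroup.map (A.val : A →+* F)
  have hinj : Function.Injective (Matrix.map · A.val : Matrix n n A → Matrix n n F) :=
    Matrix.map_injective Subtype.val_injective
  have hφ : Function.Injective φ := fun x y hxy =>
    Units.ext (hinj (congrArg Units.val hxy))
  have hgen : ∀ s ∈ S, ρ s ∈ φ.range := by
    intro s hs
    let M : Matrix n n A := Matrix.of fun i j => ⟨(ρ s).val i j, Algebra.subset_adjoin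
      (Set.mem_biUnion hs (Or.inl ⟨(i, j), rfl⟩))⟩
    let N : Matrix n n A := Matrix.of fun i j => ⟨(ρ s)⁻¹.val i j, Algebra.subset_adjoin
      (Set.mem_biUnion hs (Or.inr ⟨(i, j), rfl⟩))⟩
    have hM : M.map A.val = (ρ s).val := rfl
    have hN : N.map A.val = (ρ s)⁻¹.val := rfl
    refine ⟨⟨M, N, hinj ?_, hinj ?_⟩, Units.ext hM⟩
    · simp only [Matrix.map_mul, hM, hN, Units.mul_inv]
      exact (Matrix.map_one _ (map_zero _) (map_one _)).symm
    · simp only [Matrix.map_mul, hM, hN, Units.inv_mul]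
      exact (Matrix.map_one _ (map_zero _) (map_one _)).symm
  have hrange : ∀ g, ρ g ∈ φ.range := by
    have hle : Subgroup.closure (S : Set G) ≤ φ.range.comap ρ :=
      (Subgroup.closure_le _).2 hgen
    intro g
    exact hle (hS ▸ Subgroup.mem_top g)
  refine ⟨A, (MonoidHom.ofInjective hφ).symm.toMonoidHom.comp (ρ.codRestrict φ.range hrange),
    A.fg_iff_finiteType.1 (Subalgebra.fg_def.2 ⟨T, hT, rfl⟩), ?_⟩
  ext1 g
  exact MonoidHom.apply_ofInjective_symm hφ ⟨ρ g, hrange g⟩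

open Matrix in
/-- Malcev's theorem: the elements of a finitely generated group that a linear representation
does not kill are separated from `1` by finite-index subgroups. -/
theorem exists_finiteIndex_notMem_of_linear {G F n : Type*} [Group G] [Group.FG G] [Field F]
    [Fintype n] [DecidableEq n] (ρ : G →* GL n F) {g : G} (hg : ρ g ≠ 1) :
    ∃ H : Subgroup G, H.FiniteIndex ∧ g ∉ H := by
  obtain ⟨A, σ, hA, rfl⟩ := exists_finiteType_factorization ρ
  have hσ : σ g ≠ 1 := fun h => hg (by simp [h])
  obtain ⟨i, j, hij⟩ : ∃ i j, (σ g).val i j - (1 : Matrix n n A) i j ≠ 0 := by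
    by_contra! hall
    exact hσ (Units.ext (Matrix.ext fun i j => sub_eq_zero.1 (hall i j)))
  obtain ⟨m, hm, hmem⟩ := exists_ideal_finite_quotient_notMem hij
  let τ : G →* GL n (A ⧸ m) := (GeneralLinearGroup.map (Ideal.Quotient.mk m)).comp σ
  refine ⟨τ.ker, inferInstance, fun hker => hmem ?_⟩
  have hent : (τ g).val i j = (1 : Matrix n n (A ⧸ m)) i j := by
    rw [MonoidHom.mem_ker.1 hker, Units.val_one]
  rw [← Ideal.Quotient.eq_zero_iff_mem, map_sub, sub_eq_zero]
  refine Eq.trans hent ?_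
  rw [Matrix.one_apply, Matrix.one_apply, apply_ite (Ideal.Quotient.mk m),
    map_one, map_zero]

/-- Let `G` be a finitely generated infinite group all of whose proper subgroups
are finite.  Then `G` has no proper finite-index subgroups, and every
finite-dimensional representation `ρ : G → GL_n(F)` over any field `F` is trivial. -/
theorem stmt3 {G : Type*} [Group G] [Group.FG G] [Infinite G]
    (h : ∀ H : Subgroup G, H ≠ ⊤ → Finite H) :
    (∀ H : Subgroup G, H.FiniteIndex → H = ⊤) ∧
      ∀ (F : Type u) [Field F] (n : ℕ)
        (ρ : G →* Matrix.GeneralLinearGroup (Fin n) F) (g : G), ρ g = 1 := by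
  have htop : ∀ H : Subgroup G, H.FiniteIndex → H = ⊤ := by
    intro H hH
    by_contra hne
    have : Finite H := h H hne
    have : Finite (G ⧸ H) := H.finite_quotient_of_finiteIndex
    have : Finite G := Finite.of_equiv _ (Subgroup.groupEquivQuotientProdSubgroup (s := H)).symm
    exact not_finite G
  refine ⟨htop, fun F _ n ρ g => ?_⟩
  by_contra hg
  obtain ⟨H, hH, hgH⟩ := exists_finiteIndex_notMem_of_linear ρ hg
  exact hgH (htop H hH ▸ Subgroup.mem_top g)
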